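/- arXiv:1403.0041 — 9 statements merged into one kernel-verified Lean document; each statement's English description precedes it below -/
import Mathlib

section
/- Let A be a real N×N matrix, B a real N×M matrix, and w a real number. Then the rank of the controllability matrix [B, AB, A²B, …, A^{N−1}B] equals the rank of the controllability matrix [B, (A+wI)B, (A+wI)²B, …, (A+wI)^{N−1}B], where I is the N×N identity matrix. -/
/-- The controllability (Kalman) matrix `[B, AB, A²B, …, A^{N−1}B]` of the pair `(A, B)`,
with columns indexed by `Fin N × Fin M`: the `(k, j)` column is the `j`-th column of `A^k B`. -/
def ctrbMatrix {F : Type*} [Field F] {N M : ℕ}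
    (A : Matrix (Fin N) (Fin N) F) (B : Matrix (Fin N) (Fin M) F) :
    Matrix (Fin N) (Fin N × Fin M) F :=
  Matrix.of fun i p => (A ^ (p.1 : ℕ) * B) i p.2

/-- The binomial expansion of `(A + w • 1) ^ k`, as a sum over any `Fin n` with `k < n`. -/
theorem Matrix.add_smul_one_pow_eq_sum_fin {R ι : Type*} [CommSemiring R] [Fintype ι]
    [DecidableEq ι] (A : Matrix ι ι R) (w : R) {k n : ℕ} (hk : k < n) :
    (A + w • (1 : Matrix ι ι R)) ^ k =
      ∑ m : Fin n, (w ^ (k - m) * (k.choose m : R)) • A ^ (m : ℕ) := by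
  have hcomm : Commute A (w • (1 : Matrix ι ι R)) := (Commute.one_right A).smul_right w
  rw [hcomm.add_pow, Fin.sum_univ_eq_sum_range
    (fun m => (w ^ (k - m) * (k.choose m : R)) • A ^ m) n]
  refine (Finset.sum_congr rfl fun m _ => ?_).trans
    (Finset.sum_subset (Finset.range_mono hk) fun m _ hm => ?_)
  · rw [smul_pow, one_pow, ← nsmul_eq_mul', mul_smul_comm, mul_one, mul_comm, mul_smul,
      Nat.cast_smul_eq_nsmul]
  · rw [Nat.choose_eq_zero_of_lt (by simpa [Nat.lt_succ_iff] using hm)]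
    simp

/-- Shifting the state matrix by a scalar multiplies the controllability matrix on the right by
a matrix of binomial coefficients. -/
theorem ctrbMatrix_add_smul_one {F : Type*} [Field F] {N M : ℕ}
    (A : Matrix (Fin N) (Fin N) F) (B : Matrix (Fin N) (Fin M) F) (w : F) :
    ctrbMatrix (A + w • (1 : Matrix (Fin N) (Fin N) F)) B =
      ctrbMatrix A B * Matrix.of fun p q : Fin N × Fin M =>
        if p.2 = q.2 then w ^ ((q.1 : ℕ) - p.1) * ((q.1 : ℕ).choose p.1 : F) else 0 := by
  ext i ⟨k, j⟩
  simp only [ctrbMatrix, Matrix.of_apply, Matrix.mul_apply (M := Matrix.of _),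
    Matrix.add_smul_one_pow_eq_sum_fin A w k.isLt, Matrix.sum_mul, Matrix.sum_apply,
    Matrix.smul_mul, Matrix.smul_apply, smul_eq_mul, Fintype.sum_prod_type, mul_ite, mul_zero,
    Finset.sum_ite_eq', Finset.mem_univ, if_true]
  exact Finset.sum_congr rfl fun m _ => mul_comm _ _

theorem rank_ctrbMatrix_add_smul_one_le {F : Type*} [Field F] {N M : ℕ}
    (A : Matrix (Fin N) (Fin N) F) (B : Matrix (Fin N) (Fin M) F) (w : F) :
    (ctrbMatrix (A + w • (1 : Matrix (Fin N) (Fin N) F)) B).rank ≤ (ctrbMatrix A B).rank := by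
  rw [ctrbMatrix_add_smul_one]
  exact Matrix.rank_mul_le_left _ _

/-- Shifting the state matrix by a multiple of the identity does not change the rank of the
controllability matrix. -/
theorem rank_ctrbMatrix_add_smul_one {N M : ℕ}
    (A : Matrix (Fin N) (Fin N) ℝ) (B : Matrix (Fin N) (Fin M) ℝ) (w : ℝ) :
    (ctrbMatrix (A + w • (1 : Matrix (Fin N) (Fin N) ℝ)) B).rank = (ctrbMatrix A B).rank := by
  refine le_antisymm (rank_ctrbMatrix_add_smul_one_le A B w) ?_
  simpa [add_assoc] using
    rank_ctrbMatrix_add_smul_one_le (A + w • (1 : Matrix (Fin N) (Fin N) ℝ)) B (-w)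
end

section
/- (PBH necessity, eigenvector form) Let A be a complex N×N matrix and B a complex N×M matrix. If there exist a complex number λ and a nonzero vector v ∈ ℂ^N with Aᵀ v = λ v and Bᵀ v = 0, then (A,B) is not Kalman controllable. -/
/-- The pair `(A, B)` is Kalman controllable iff its controllability matrix has full rank `N`. -/
def KalmanControllable {F : Type*} [Field F] {N M : ℕ}
    (A : Matrix (Fin N) (Fin N) F) (B : Matrix (Fin N) (Fin M) F) : Prop :=
  (ctrbMatrix A B).rank = N

open scoped Matrix in
theorem vecMul_pow_of_vecMul_eq_smul {R n : Type*} [CommSemiring R] [Fintype n] [DecidableEq n]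
    {A : Matrix n n R} {c : R} {v : n → R} (h : v ᵥ* A = c • v) (k : ℕ) :
    v ᵥ* A ^ k = c ^ k • v := by
  induction k with
  | zero => simp
  | succ k ih => rw [pow_succ, ← Matrix.vecMul_vecMul, ih, Matrix.smul_vecMul, h, smul_smul, pow_succ]

open scoped Matrix in
theorem vecMul_ctrbMatrix_eq_zero {F : Type*} [Field F] {N M : ℕ}
    {A : Matrix (Fin N) (Fin N) F} {B : Matrix (Fin N) (Fin M) F} {c : F} {v : Fin N → F}
    (hA : v ᵥ* A = c • v) (hB : v ᵥ* B = 0) : v ᵥ* ctrbMatrix A B = 0 := by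
  ext ⟨k, j⟩
  change (v ᵥ* (A ^ (k : ℕ) * B)) j = 0
  rw [← Matrix.vecMul_vecMul, vecMul_pow_of_vecMul_eq_smul hA, Matrix.smul_vecMul, hB, smul_zero,
    Pi.zero_apply]

open scoped Matrix in
theorem KalmanControllable.vecMul_injective {F : Type*} [Field F] {N M : ℕ}
    {A : Matrix (Fin N) (Fin N) F} {B : Matrix (Fin N) (Fin M) F} (h : KalmanControllable A B) :
    Function.Injective fun v => v ᵥ* ctrbMatrix A B := by
  refine Matrix.vecMul_injective_iff.mpr (linearIndependent_iff_card_eq_finrank_span.mpr ?_)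
  rw [Fintype.card_fin, Set.finrank, ← Matrix.rank_eq_finrank_span_row]
  exact h.symm

/-- PBH necessity, eigenvector form: if some nonzero `v` satisfies `Aᵀ v = λ v` and
`Bᵀ v = 0`, then `(A, B)` is not Kalman controllable. -/
theorem pbh_necessity_eigenvector {N M : ℕ}
    (A : Matrix (Fin N) (Fin N) ℂ) (B : Matrix (Fin N) (Fin M) ℂ)
    (lam : ℂ) (v : Fin N → ℂ) (hv : v ≠ 0)
    (hA : A.transpose.mulVec v = lam • v) (hB : B.transpose.mulVec v = 0) :
    ¬ KalmanControllable A B := by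
  rw [Matrix.mulVec_transpose] at hA hB
  intro h
  refine hv (h.vecMul_injective ?_)
  simp only [vecMul_ctrbMatrix_eq_zero hA hB, Matrix.zero_vecMul]
end

section
/- (Upper bound of exact controllability theory) Let A be a complex N×N matrix with N ≥ 1, and let μ_max be the maximum over all eigenvalues λ of A of the geometric multiplicity N − rank(λI − A). Then there exists a complex N×μ_max matrix B such that (A,B) is Kalman controllable. -/
/-- A subspace `W` stable under `T` is everything as soon as it spans the whole space
together with the range of `lam - T`, for every scalar `lam` (the Popov–Belevitch–Hautus test). -/
theorem Submodule.eq_top_of_forall_sup_range_eq_top {K V : Type*} [Field K] [IsAlgClosed K]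
    [AddCommGroup V] [Module K V] [FiniteDimensional K V] (T : Module.End K V)
    (W : Submodule K V) (hW : W ≤ W.comap T)
    (h : ∀ lam : K, W ⊔ LinearMap.range (lam • (1 : Module.End K V) - T) = ⊤) : W = ⊤ := by
  by_contra hne
  have : Nontrivial (V ⧸ W) := Submodule.Quotient.nontrivial_iff.2 hne
  obtain ⟨lam, hlam⟩ := Module.End.exists_eigenvalue (W.mapQ W T hW : Module.End K (V ⧸ W))
  obtain ⟨v, hv⟩ := hlam.exists_hasEigenvector
  let S : Module.End K (V ⧸ W) := lam • 1 - W.mapQ W T hW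
  have hsurj : Function.Surjective S := by
    intro x
    obtain ⟨y, rfl⟩ := W.mkQ_surjective x
    obtain ⟨w, hw, z, ⟨u, rfl⟩, rfl⟩ := Submodule.mem_sup.1 (h lam ▸ Submodule.mem_top : y ∈ _)
    refine ⟨W.mkQ u, ?_⟩
    have hw0 : W.mkQ w = 0 := by simpa using hw
    rw [map_add, hw0, zero_add]
    simp [S]
  have hinj : Function.Injective S := LinearMap.injective_iff_surjective.2 hsurj
  refine hv.2 (hinj ?_)
  simp [S, hv.apply_eq_smul]

theorem Submodule.exists_span_range_sup_eq_top {K V : Type*} [Field K] [AddCommGroup V]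
    [Module K V] [FiniteDimensional K V] (U : Submodule K V) {m : ℕ}
    (hm : Module.finrank K (V ⧸ U) ≤ m) :
    ∃ c : Fin m → V, Submodule.span K (Set.range c) ⊔ U = ⊤ := by
  let e := Module.finBasis K (V ⧸ U)
  choose g hg using fun i => U.mkQ_surjective (e i)
  refine ⟨fun i => if h : (i : ℕ) < Module.finrank K (V ⧸ U) then g ⟨i, h⟩ else 0, ?_⟩
  rw [sup_comm, ← Submodule.map_mkQ_eq_top, Submodule.map_span, eq_top_iff, ← e.span_eq, Submodule.span_le]
  rintro _ ⟨i, rfl⟩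
  refine Submodule.subset_span ⟨_, ⟨Fin.castLE hm i, rfl⟩, ?_⟩
  simp [hg]

theorem Module.End.aeval_apply_sub_eval_smul_mem_range {K V : Type*} [Field K] [AddCommGroup V]
    [Module K V] (T : Module.End K V) (p : Polynomial K) (lam : K) (v : V) :
    Polynomial.aeval T p v - p.eval lam • v ∈ LinearMap.range (lam • (1 : Module.End K V) - T) := by
  obtain ⟨q, hq⟩ := Polynomial.X_sub_C_dvd_sub_C_eval (a := lam) (p := p)
  refine ⟨-(Polynomial.aeval T q v), ?_⟩
  have := congrArg (fun r => Polynomial.aeval T r v) hq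
  simp only [map_sub, map_mul, Polynomial.aeval_X, Polynomial.aeval_C, LinearMap.sub_apply,
    Module.End.mul_apply, Module.algebraMap_end_apply] at this
  rw [this]
  simp [neg_add_eq_sub]

/-- Vectors spanning the cokernel of `lam - T` can be chosen simultaneously for finitely many
scalars `lam`, by Lagrange interpolation. -/
theorem Module.End.exists_forall_span_sup_range_eq_top {K V : Type*} [Field K] [AddCommGroup V]
    [Module K V] [FiniteDimensional K V] (T : Module.End K V) (s : Finset K) {m : ℕ}
    (hm : ∀ lam ∈ s,
      Module.finrank K (V ⧸ LinearMap.range (lam • (1 : Module.End K V) - T)) ≤ m) :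
    ∃ b : Fin m → V, ∀ lam ∈ s, Submodule.span K (Set.range b) ⊔
      LinearMap.range (lam • (1 : Module.End K V) - T) = ⊤ := by
  classical
  choose! c hc using fun lam hlam =>
    Submodule.exists_span_range_sup_eq_top _ (hm lam hlam)
  refine ⟨fun j => ∑ a ∈ s, Polynomial.aeval T (Lagrange.basis s id a) (c a j),
    fun lam hlam => ?_⟩
  rw [eq_top_iff, ← hc lam hlam, sup_le_iff]
  refine ⟨Submodule.span_le.2 ?_, le_sup_right⟩
  rintro _ ⟨j, rfl⟩
  have hsum : ∑ a ∈ s, (Lagrange.basis s id a).eval lam • c a j = c lam j := by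
    rw [Finset.sum_eq_single_of_mem lam hlam]
    · have := Lagrange.eval_basis_self (v := id) (Set.injOn_id (s : Set K)) hlam
      rw [id] at this
      rw [this, one_smul]
    · intro a _ ha
      have := Lagrange.eval_basis_of_ne (v := id) ha hlam
      rw [id] at this
      rw [this, zero_smul]
  have hmem := Submodule.sum_mem _ fun a (_ : a ∈ s) =>
    T.aeval_apply_sub_eval_smul_mem_range (Lagrange.basis s id a) lam (c a j)
  rw [Finset.sum_sub_distrib, hsum] at hmem
  rw [SetLike.mem_coe, ← sub_sub_cancel (∑ a ∈ s, Polynomial.aeval T (Lagrange.basis s id a)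
    (c a j)) (c lam j)]
  exact sub_mem (Submodule.mem_sup_left (Submodule.subset_span ⟨j, rfl⟩))
    (Submodule.mem_sup_right hmem)

/-- By Cayley–Hamilton, the columns of the controllability matrix span all the columns
of `A ^ k * B`. -/
theorem pow_mulVec_col_mem_span_col_ctrbMatrix {F : Type*} [Field F] {N M : ℕ}
    (A : Matrix (Fin N) (Fin N) F) (B : Matrix (Fin N) (Fin M) F) (k : ℕ) (j : Fin M) :
    (A ^ k).mulVec (B.col j) ∈ Submodule.span F (Set.range (ctrbMatrix A B).col) := by
  rcases Nat.eq_zero_or_pos N with rfl | hpos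
  · rw [Subsingleton.elim ((A ^ k).mulVec (B.col j)) 0]
    exact zero_mem _
  have hdeg : (Polynomial.X ^ k %ₘ A.charpoly).natDegree < N := by
    have hdegA : A.charpoly.natDegree = N := by simp
    have := Polynomial.natDegree_modByMonic_lt (Polynomial.X ^ k) A.charpoly_monic
      (fun h => by rw [h, Polynomial.natDegree_one] at hdegA; omega)
    rwa [hdegA] at this
  rw [Matrix.pow_eq_aeval_mod_charpoly, Polynomial.aeval_eq_sum_range, Matrix.sum_mulVec]
  refine Submodule.sum_mem _ fun i hi => ?_
  rw [Matrix.smul_mulVec]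
  refine Submodule.smul_mem _ _ (Submodule.subset_span ⟨(⟨i, ?_⟩, j), ?_⟩)
  · have := Finset.mem_range.1 hi
    omega
  · rfl

theorem kalmanControllable_of_forall_sup_range_eq_top {F : Type*} [Field F] [IsAlgClosed F]
    {N M : ℕ} (A : Matrix (Fin N) (Fin N) F) (B : Matrix (Fin N) (Fin M) F)
    (h : ∀ lam : F, Submodule.span F (Set.range B.col) ⊔
      LinearMap.range (lam • (1 : Module.End F (Fin N → F)) - A.toLin') = ⊤) :
    KalmanControllable A B := by
  have htop : Submodule.span F (Set.range (ctrbMatrix A B).col) = ⊤ := by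
    refine Submodule.eq_top_of_forall_sup_range_eq_top A.toLin' _ ?_ fun lam => ?_
    · rw [Submodule.span_le]
      rintro _ ⟨⟨k, j⟩, rfl⟩
      have := pow_mulVec_col_mem_span_col_ctrbMatrix A B (k + 1) j
      rw [pow_succ', ← Matrix.mulVec_mulVec] at this
      exact this
    · rw [eq_top_iff, ← h lam]
      refine sup_le_sup_right (Submodule.span_le.2 ?_) _
      rintro _ ⟨j, rfl⟩
      simpa using pow_mulVec_col_mem_span_col_ctrbMatrix A B 0 j
  rw [KalmanControllable, Matrix.rank_eq_finrank_span_cols, htop, finrank_top]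
  simp

/-- Upper bound of exact controllability theory: if `μmax` is the maximum geometric
multiplicity `N − rank(λI − A)` over the eigenvalues `λ` of `A`, then some `N × μmax`
control matrix `B` makes `(A, B)` Kalman controllable. -/
theorem ect_upper_bound {N : ℕ} (hN : 1 ≤ N) (A : Matrix (Fin N) (Fin N) ℂ) (μmax : ℕ)
    (hμ : μmax = sSup {m : ℕ | ∃ lam : ℂ, (lam • (1 : Matrix (Fin N) (Fin N) ℂ) - A).det = 0 ∧
      m = N - (lam • (1 : Matrix (Fin N) (Fin N) ℂ) - A).rank}) :
    ∃ B : Matrix (Fin N) (Fin μmax) ℂ, KalmanControllable A B := by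
  subst hμ
  have hlin (lam : ℂ) : lam • (1 : Module.End ℂ (Fin N → ℂ)) - A.toLin' =
      (lam • (1 : Matrix (Fin N) (Fin N) ℂ) - A).toLin' := by
    rw [map_sub, map_smul, Matrix.toLin'_one]
    rfl
  have hdet (lam : ℂ) :
      A.charpoly.eval lam = (lam • (1 : Matrix (Fin N) (Fin N) ℂ) - A).det := by
    rw [Matrix.eval_charpoly, Matrix.scalar_apply, ← Matrix.smul_one_eq_diagonal]
  obtain ⟨b, hb⟩ := Module.End.exists_forall_span_sup_range_eq_top A.toLin'
    A.charpoly.roots.toFinset (m := sSup {m : ℕ | ∃ lam : ℂ,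
      (lam • (1 : Matrix (Fin N) (Fin N) ℂ) - A).det = 0 ∧
      m = N - (lam • (1 : Matrix (Fin N) (Fin N) ℂ) - A).rank}) fun lam hlam => by
    refine le_csSup ⟨N, ?_⟩ ⟨lam, ?_, ?_⟩
    · rintro _ ⟨_, _, rfl⟩
      exact Nat.sub_le _ _
    · rw [← hdet]
      exact (Polynomial.mem_roots'.1 (Multiset.mem_toFinset.1 hlam)).2
    · rw [hlin, Submodule.finrank_quotient, Module.finrank_fin_fun]
      rfl
  refine ⟨(Matrix.of b).transpose, kalmanControllable_of_forall_sup_range_eq_top _ _ fun lam => ?_⟩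
  by_cases hlam : A.charpoly.eval lam = 0
  · exact hb lam (Multiset.mem_toFinset.2
      (Polynomial.mem_roots'.2 ⟨A.charpoly_monic.ne_zero, hlam⟩))
  · rw [hdet] at hlam
    rw [hlin, LinearMap.range_eq_top.2, sup_top_eq]
    exact Matrix.mulVec_surjective_iff_isUnit.2
      ((Matrix.isUnit_iff_isUnit_det _).2 (isUnit_iff_ne_zero.2 hlam))
end

section
/- (Exact controllability theory over ℂ) Let A be a complex N×N matrix with N ≥ 1. Then the minimum number of driver nodes N_D, i.e., the least M ≥ 1 for which there exists a complex N×M matrix B with (A,B) Kalman controllable, equals the maximum over all eigenvalues λ of A of the geometric multiplicity N − rank(λI − A). -/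
open Matrix Module in
/-- A matrix has full row rank iff no nonzero vector is annihilated by its transpose. -/
theorem Matrix.rank_eq_card_iff_transpose_mulVec {F m n : Type*} [Field F] [Fintype m] [Fintype n]
    (K : Matrix m n F) :
    K.rank = Fintype.card m ↔ ∀ w, Kᵀ *ᵥ w = 0 → w = 0 := by
  have h := Kᵀ.mulVecLin.finrank_range_add_finrank_ker
  rw [finrank_pi, ← Matrix.rank, rank_transpose] at h
  rw [← ker_mulVecLin_eq_bot_iff, ← Submodule.finrank_eq_zero]
  omega

open Matrix in
theorem ctrbMatrix_transpose_mulVec {F : Type*} [Field F] {N M : ℕ}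
    (A : Matrix (Fin N) (Fin N) F) (B : Matrix (Fin N) (Fin M) F) (w : Fin N → F)
    (p : Fin N × Fin M) :
    ((ctrbMatrix A B)ᵀ *ᵥ w) p = (Bᵀ *ᵥ (Aᵀ ^ (p.1 : ℕ) *ᵥ w)) p.2 := by
  rw [mulVec_mulVec, ← transpose_pow, ← transpose_mul]
  rfl

open Matrix in
theorem kalmanControllable_iff_forall_lt {F : Type*} [Field F] {N M : ℕ}
    (A : Matrix (Fin N) (Fin N) F) (B : Matrix (Fin N) (Fin M) F) :
    KalmanControllable A B ↔ ∀ w, (∀ k < N, Bᵀ *ᵥ (Aᵀ ^ k *ᵥ w) = 0) → w = 0 := by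
  have h := (ctrbMatrix A B).rank_eq_card_iff_transpose_mulVec
  rw [Fintype.card_fin] at h
  rw [KalmanControllable, h]
  refine forall_congr' fun w => imp_congr_left ⟨fun hw k hk => funext fun j => ?_,
    fun hw => funext fun p => ?_⟩
  · simpa [ctrbMatrix_transpose_mulVec] using congrFun hw (⟨k, hk⟩, j)
  · rw [ctrbMatrix_transpose_mulVec, hw _ p.1.2]
    rfl

open Matrix Polynomial in
/-- By Cayley–Hamilton, vanishing of `C Aᵏ w` for `k < N` forces it for all `k`. -/
theorem Matrix.mulVec_pow_mulVec_eq_zero {F : Type*} [Field F] {N M : ℕ}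
    (A : Matrix (Fin N) (Fin N) F) (C : Matrix (Fin M) (Fin N) F) (w : Fin N → F)
    (h : ∀ k < N, C *ᵥ (A ^ k *ᵥ w) = 0) (k : ℕ) : C *ᵥ (A ^ k *ᵥ w) = 0 := by
  rw [A.pow_eq_aeval_mod_charpoly, aeval_eq_sum_range, sum_mulVec, mulVec_sum]
  refine Finset.sum_eq_zero fun i _ => ?_
  rw [smul_mulVec, mulVec_smul]
  by_cases hi : i < N
  · rw [h i hi, smul_zero]
  · rw [coeff_eq_zero_of_degree_lt, zero_smul]
    refine (degree_modByMonic_lt _ A.charpoly_monic).trans_le ?_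
    rw [A.charpoly_degree_eq_dim, Fintype.card_fin]
    exact_mod_cast not_lt.mp hi

open Matrix in
/-- The Popov–Belevitch–Hautus test: `(A, B)` is controllable iff `Bᵀ` kills no eigenvector
of `Aᵀ`. -/
theorem kalmanControllable_iff_eigenvector {F : Type*} [Field F] [IsAlgClosed F] {N M : ℕ}
    (A : Matrix (Fin N) (Fin N) F) (B : Matrix (Fin N) (Fin M) F) :
    KalmanControllable A B ↔
      ∀ (lam : F) (w : Fin N → F), Aᵀ *ᵥ w = lam • w → Bᵀ *ᵥ w = 0 → w = 0 := by
  rw [kalmanControllable_iff_forall_lt]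
  constructor
  · intro h lam w hA hB
    have hpow (k : ℕ) : Aᵀ ^ k *ᵥ w = lam ^ k • w := by
      induction k with
      | zero => simp
      | succ k ih => rw [pow_succ, ← mulVec_mulVec, hA, mulVec_smul, ih, smul_smul, pow_succ']
    exact h w fun k _ => by rw [hpow, mulVec_smul, hB, smul_zero]
  · intro h w hw
    by_contra hw0
    let W : Submodule F (Fin N → F) := ⨅ k : ℕ, LinearMap.ker (Bᵀ * Aᵀ ^ k).mulVecLin
    have mem_W (v) : v ∈ W ↔ ∀ k, Bᵀ *ᵥ (Aᵀ ^ k *ᵥ v) = 0 := by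
      simp only [W, Submodule.mem_iInf, LinearMap.mem_ker, mulVecLin_apply, mulVec_mulVec]
    have hinv : ∀ v ∈ W, Aᵀ.mulVecLin v ∈ W := by
      intro v hv
      rw [mem_W] at hv ⊢
      intro k
      rw [mulVecLin_apply, mulVec_mulVec (N := Aᵀ), ← pow_succ]
      exact hv (k + 1)
    have hwW : w ∈ W := (mem_W w).2 (mulVec_pow_mulVec_eq_zero _ _ w hw)
    have : Nontrivial W := ⟨⟨w, hwW⟩, 0, fun e => hw0 (congrArg Subtype.val e)⟩
    obtain ⟨lam, hlam⟩ := Module.End.exists_eigenvalue (Aᵀ.mulVecLin.restrict hinv)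
    obtain ⟨v, hv⟩ := hlam.exists_hasEigenvector
    refine hv.2 (Subtype.ext (h lam v (congrArg Subtype.val hv.apply_eq_smul) ?_))
    simpa using (mem_W v).1 v.2 0

open Module in
/-- If every eigenspace of `f` has dimension at most `dim W`, then some linear map to `W` is
injective on each eigenspace. -/
theorem Module.End.exists_linearMap_injective_on_eigenspaces {F V W : Type*} [Field F]
    [AddCommGroup V] [Module F V] [FiniteDimensional F V]
    [AddCommGroup W] [Module F W] [FiniteDimensional F W] (f : End F V)
    (h : ∀ lam, finrank F (f.eigenspace lam) ≤ finrank F W) :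
    ∃ g : V →ₗ[F] W, ∀ lam, ∀ w ∈ f.eigenspace lam, g w = 0 → w = 0 := by
  classical
  choose φ hφ using fun lam => finrank_le_iff_exists_linearMap.1 (h lam)
  obtain ⟨T, hT⟩ := LinearMap.exists_leftInverse_of_injective
    (DFinsupp.lsum F fun lam => (f.eigenspace lam).subtype)
    (LinearMap.ker_eq_bot.2 f.eigenspaces_iSupIndep.dfinsupp_lsum_injective)
  refine ⟨DFinsupp.lsum F φ ∘ₗ T, fun lam w hw hg => ?_⟩
  have key := LinearMap.congr_fun hT (DFinsupp.single lam ⟨w, hw⟩)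
  simp only [LinearMap.comp_apply, DFinsupp.lsum_single, Submodule.subtype_apply,
    LinearMap.id_apply] at key
  rw [LinearMap.comp_apply, key, DFinsupp.lsum_single] at hg
  exact congrArg Subtype.val ((map_eq_zero_iff _ (hφ lam)).1 hg)

open Matrix Module in
theorem Matrix.finrank_eigenspace_transpose_mulVecLin {F n : Type*} [Field F] [Fintype n]
    [DecidableEq n] (A : Matrix n n F) (lam : F) :
    finrank F (End.eigenspace Aᵀ.mulVecLin lam) =
      Fintype.card n - (lam • (1 : Matrix n n F) - A).rank := by
  have h := ((lam • (1 : Matrix n n F) - A)ᵀ).mulVecLin.finrank_range_add_finrank_ker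
  rw [finrank_pi, ← Matrix.rank, rank_transpose] at h
  have hker : End.eigenspace Aᵀ.mulVecLin lam =
      LinearMap.ker ((lam • (1 : Matrix n n F) - A)ᵀ).mulVecLin := by
    ext w
    simp [sub_eq_zero, eq_comm]
  rw [hker]
  omega

open Matrix Module in
/-- `M` inputs suffice to control `A` iff no geometric multiplicity exceeds `M`. -/
theorem exists_kalmanControllable_iff {F : Type*} [Field F] [IsAlgClosed F] {N M : ℕ}
    (A : Matrix (Fin N) (Fin N) F) :
    (∃ B : Matrix (Fin N) (Fin M) F, KalmanControllable A B) ↔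
      ∀ lam : F, N - (lam • (1 : Matrix (Fin N) (Fin N) F) - A).rank ≤ M := by
  have hd (lam : F) := A.finrank_eigenspace_transpose_mulVecLin lam
  simp only [Fintype.card_fin] at hd
  simp only [← hd, kalmanControllable_iff_eigenvector]
  constructor
  · rintro ⟨B, hB⟩ lam
    have hinj : Function.Injective
        (Bᵀ.mulVecLin ∘ₗ (End.eigenspace Aᵀ.mulVecLin lam).subtype) := by
      rw [injective_iff_map_eq_zero]
      exact fun w hw => Subtype.ext (hB lam w (End.mem_eigenspace_iff.1 w.2) hw)
    simpa using LinearMap.finrank_le_finrank_of_injective hinj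
  · intro h
    obtain ⟨g, hg⟩ := End.exists_linearMap_injective_on_eigenspaces
      (W := Fin M → F) Aᵀ.mulVecLin (by simpa using h)
    refine ⟨(LinearMap.toMatrix' g)ᵀ, fun lam w hw hB => hg lam w (End.mem_eigenspace_iff.2 hw) ?_⟩
    simpa [LinearMap.toMatrix'_mulVec] using hB

/-- Exact controllability theory over `ℂ`: the minimum number of driver nodes, i.e. the least
`M ≥ 1` admitting an `N × M` control matrix `B` with `(A, B)` Kalman controllable, equals the
maximum geometric multiplicity `N − rank(λI − A)` over the eigenvalues `λ` of `A`. -/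
theorem exact_controllability {N : ℕ} (hN : 1 ≤ N) (A : Matrix (Fin N) (Fin N) ℂ) :
    sInf {M : ℕ | 1 ≤ M ∧ ∃ B : Matrix (Fin N) (Fin M) ℂ, KalmanControllable A B} =
      sSup {m : ℕ | ∃ lam : ℂ, (lam • (1 : Matrix (Fin N) (Fin N) ℂ) - A).det = 0 ∧
        m = N - (lam • (1 : Matrix (Fin N) (Fin N) ℂ) - A).rank} := by
  simp only [exists_kalmanControllable_iff]
  set d : ℂ → ℕ := fun lam => N - (lam • (1 : Matrix (Fin N) (Fin N) ℂ) - A).rank with hd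
  have : Nonempty (Fin N) := ⟨⟨0, hN⟩⟩
  obtain ⟨lam₀, hlam₀⟩ := IsAlgClosed.exists_root A.charpoly (by
    rw [A.charpoly_degree_eq_dim, Fintype.card_fin]
    exact_mod_cast (by omega : N ≠ 0))
  have hdet₀ : (lam₀ • (1 : Matrix (Fin N) (Fin N) ℂ) - A).det = 0 := by
    rw [Polynomial.IsRoot, Matrix.eval_charpoly] at hlam₀
    rwa [Matrix.smul_one_eq_diagonal]
  have hbdd : BddAbove {m : ℕ | ∃ lam : ℂ,
      (lam • (1 : Matrix (Fin N) (Fin N) ℂ) - A).det = 0 ∧ m = d lam} :=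
    ⟨N, by rintro _ ⟨lam, -, rfl⟩; exact Nat.sub_le _ _⟩
  have hpos {lam : ℂ} : (lam • (1 : Matrix (Fin N) (Fin N) ℂ) - A).det = 0 → 1 ≤ d lam := by
    intro hdet
    obtain ⟨v, hv, hv0⟩ := Matrix.exists_mulVec_eq_zero_iff.2
      ((Matrix.det_transpose _).trans hdet)
    have hne : (lam • (1 : Matrix (Fin N) (Fin N) ℂ) - A).rank ≠ N := fun e =>
      hv ((Matrix.rank_eq_card_iff_transpose_mulVec _).1 (by rwa [Fintype.card_fin]) v hv0)
    have := (lam • (1 : Matrix (Fin N) (Fin N) ℂ) - A).rank_le_width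
    simp only [hd]
    omega
  refine le_antisymm (Nat.sInf_le ⟨?_, fun lam => ?_⟩) ?_
  · exact (hpos hdet₀).trans (le_csSup hbdd ⟨lam₀, hdet₀, rfl⟩)
  · by_cases hdet : (lam • (1 : Matrix (Fin N) (Fin N) ℂ) - A).det = 0
    · exact le_csSup hbdd ⟨lam, hdet, rfl⟩
    · simp [Matrix.rank_of_det_ne_zero hdet]
  · refine le_csInf ⟨N, hN, fun lam => Nat.sub_le _ _⟩ ?_
    rintro M ⟨-, hM⟩
    refine csSup_le ⟨_, lam₀, hdet₀, rfl⟩ ?_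
    rintro _ ⟨lam, -, rfl⟩
    exact hM lam
end

section
/- (Exact controllability theory for real state matrices) Let A be a real N×N matrix with N ≥ 1. Then the least M ≥ 1 for which there exists a real N×M matrix B with (A,B) Kalman controllable equals the maximum, over all complex eigenvalues λ of A (viewed as a complex matrix), of the geometric multiplicity N − rank_ℂ(λI − A). -/
open scoped Matrix

/-- A matrix with `N` rows has rank `N` iff its left kernel is trivial. -/
theorem Matrix.rank_eq_iff_vecMul_eq_zero {F ι : Type*} [Field F] [Fintype ι] {N : ℕ}
    (K : Matrix (Fin N) ι F) : K.rank = N ↔ ∀ v, v ᵥ* K = 0 → v = 0 := by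
  have h : K.rank = N ↔ LinearIndependent F K.row := by
    rw [linearIndependent_iff_card_eq_finrank_span, Matrix.rank_eq_finrank_span_row,
      Fintype.card_fin, eq_comm]
    rfl
  rw [h, ← Matrix.vecMul_injective_iff]
  exact injective_iff_map_eq_zero (Matrix.vecMulLinear K)

/-- The dimension of the left kernel of a square matrix. -/
theorem Matrix.finrank_ker_mulVecLin_transpose {F : Type*} [Field F] {N : ℕ}
    (P : Matrix (Fin N) (Fin N) F) :
    Module.finrank F (LinearMap.ker Pᵀ.mulVecLin) = N - P.rank := by
  have h := LinearMap.finrank_range_add_finrank_ker Pᵀ.mulVecLin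
  rw [Module.finrank_fin_fun] at h
  have h2 : Module.finrank F (LinearMap.range Pᵀ.mulVecLin) = P.rank := P.rank_transpose
  omega

/-- By the Cayley–Hamilton theorem, the left kernel of the controllability matrix annihilates
`A ^ k * B` for every `k`. -/
theorem vecMul_pow_mul_eq_zero_of_vecMul_ctrbMatrix {F : Type*} [Field F] {N M : ℕ}
    {A : Matrix (Fin N) (Fin N) F} {B : Matrix (Fin N) (Fin M) F} {v : Fin N → F}
    (hv : v ᵥ* ctrbMatrix A B = 0) (k : ℕ) : v ᵥ* (A ^ k * B) = 0 := by
  have hlt : ∀ i < N, v ᵥ* (A ^ i * B) = 0 := fun i hi => by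
    ext j
    exact congrFun hv (⟨i, hi⟩, j)
  rcases Nat.eq_zero_or_pos N with rfl | hN
  · rw [Subsingleton.elim v 0, Matrix.zero_vecMul]
  have hdeg : (Polynomial.X ^ k %ₘ A.charpoly).natDegree < N := by
    have h := Polynomial.natDegree_modByMonic_lt (Polynomial.X ^ k) A.charpoly_monic
      (fun h => by
        have := A.charpoly_natDegree_eq_dim
        simp [h] at this
        omega)
    simpa using h
  rw [A.pow_eq_aeval_mod_charpoly k, Polynomial.aeval_eq_sum_range' hdeg, Matrix.sum_mul,
    Matrix.vecMul_sum]
  refine Finset.sum_eq_zero fun i hi => ?_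
  rw [Matrix.smul_mul, Matrix.vecMul_smul, hlt i (Finset.mem_range.mp hi), smul_zero]

/-- A finite family of complex subspaces of dimension at most `m` can be separated from zero
by `m` real linear forms. -/
theorem exists_real_forms_separating {N : ℕ} (m : ℕ) {ι : Type*} (s : Finset ι) :
    ∀ W : ι → Submodule ℂ (Fin N → ℂ), (∀ i ∈ s, Module.finrank ℂ (W i) ≤ m) →
      ∃ b : Fin m → Fin N → ℝ, ∀ i ∈ s, ∀ w ∈ W i,
        (∀ j, w ⬝ᵥ (fun l => (b j l : ℂ)) = 0) → w = 0 := by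
  induction m with
  | zero =>
    intro W hW
    refine ⟨Fin.elim0, fun i hi w hw _ => ?_⟩
    have h := Submodule.finrank_eq_zero.mp (Nat.le_zero.mp (hW i hi))
    simpa [h] using hw
  | succ m ih =>
    intro W hW
    classical
    let ann : ι → Submodule ℝ (Fin N → ℝ) := fun i =>
      { carrier := {b | ∀ w ∈ W i, w ⬝ᵥ (fun l => (b l : ℂ)) = 0}
        zero_mem' := fun w _ => by simp [dotProduct]
        add_mem' := fun {a b} ha hb w hw => by
          have h1 := ha w hw
          have h2 := hb w hw
          simp only [dotProduct] at h1 h2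
          simp [dotProduct, mul_add, Finset.sum_add_distrib, h1, h2]
        smul_mem' := fun c a ha w hw => by
          have h1 := ha w hw
          simp only [dotProduct] at h1
          simp [dotProduct, mul_left_comm _ (c : ℂ), ← Finset.mul_sum, h1] }
    obtain ⟨b, hb⟩ : ∃ b, ∀ i ∈ s, W i ≠ ⊥ → b ∉ ann i := by
      have h := Subspace.biUnion_ne_univ_of_top_notMem (k := ℝ)
        (s := (s.filter fun i => W i ≠ ⊥).image ann) (by
          simp only [Finset.mem_image, Finset.mem_filter, not_exists, not_and, and_imp]
          intro i _ hne htop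
          refine hne ((Submodule.eq_bot_iff _).mpr fun w hw => ?_)
          ext l
          have hl : (Pi.single l 1 : Fin N → ℝ) ∈ ann i := htop ▸ Submodule.mem_top
          simpa [dotProduct, Pi.single_apply, apply_ite Complex.ofReal] using hl w hw)
      obtain ⟨b, hb⟩ := (Set.ne_univ_iff_exists_notMem _).mp h
      refine ⟨b, fun i hi hne hbi => hb ?_⟩
      simp only [Set.mem_iUnion]
      exact ⟨ann i, Finset.mem_image_of_mem _ (Finset.mem_filter.mpr ⟨hi, hne⟩), hbi⟩
    let φ : (Fin N → ℂ) →ₗ[ℂ] ℂ :=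
      (dotProductBilin ℂ ℂ).flip (fun l => (b l : ℂ))
    obtain ⟨b', hb'⟩ := ih (fun i => W i ⊓ LinearMap.ker φ) (fun i hi => by
      by_cases hne : W i = ⊥
      · rw [hne, bot_inf_eq, finrank_bot]
        exact Nat.zero_le m
      have hlt : W i ⊓ LinearMap.ker φ < W i := by
        refine lt_of_le_of_ne inf_le_left fun h => hb i hi hne fun w hw => ?_
        exact (inf_eq_left.mp h) hw
      have := Submodule.finrank_lt_finrank_of_lt hlt
      have := hW i hi
      omega)
    refine ⟨Fin.cons b b', fun i hi w hw h => hb' i hi w ⟨hw, ?_⟩ fun j => ?_⟩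
    · exact h 0
    · simpa using h j.succ

/-- Membership in the left eigenspace. -/
theorem mem_ker_transpose_smul_one_sub {F : Type*} [Field F] {N : ℕ}
    {P : Matrix (Fin N) (Fin N) F} {c : F} {w : Fin N → F} :
    w ∈ LinearMap.ker (c • (1 : Matrix (Fin N) (Fin N) F) - P)ᵀ.mulVecLin ↔
      w ᵥ* P = c • w := by
  rw [LinearMap.mem_ker, Matrix.mulVecLin_apply, Matrix.mulVec_transpose, Matrix.vecMul_sub,
    Matrix.vecMul_smul, Matrix.vecMul_one, sub_eq_zero, eq_comm]

theorem Matrix.vecMul_pow_of_eigen {F : Type*} [Field F] {N : ℕ}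
    {P : Matrix (Fin N) (Fin N) F} {c : F} {w : Fin N → F} (h : w ᵥ* P = c • w) (k : ℕ) :
    w ᵥ* P ^ k = c ^ k • w := by
  induction k with
  | zero => simp
  | succ k ih => rw [pow_succ, ← Matrix.vecMul_vecMul, ih, Matrix.smul_vecMul, h, smul_smul,
    pow_succ]

/-- A real matrix with trivial real left kernel has trivial complex left kernel. -/
theorem Matrix.eq_zero_of_vecMul_map_ofReal {ι : Type*} {N : ℕ}
    {K : Matrix (Fin N) ι ℝ} (hK : ∀ v, v ᵥ* K = 0 → v = 0) {w : Fin N → ℂ}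
    (hw : w ᵥ* K.map Complex.ofReal = 0) : w = 0 := by
  have hre := hK (fun i => (w i).re) (by
    ext j
    simpa [Matrix.vecMul, dotProduct] using congrArg Complex.re (congrFun hw j))
  have him := hK (fun i => (w i).im) (by
    ext j
    simpa [Matrix.vecMul, dotProduct] using congrArg Complex.im (congrFun hw j))
  ext i
  exact Complex.ext (congrFun hre i) (congrFun him i)

theorem Matrix.map_ofReal_pow_mul {N M : ℕ} (A : Matrix (Fin N) (Fin N) ℝ)
    (B : Matrix (Fin N) (Fin M) ℝ) (k : ℕ) :
    (A ^ k * B).map Complex.ofReal = A.map Complex.ofReal ^ k * B.map Complex.ofReal := by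
  have h := Matrix.map_mul (L := A ^ k) (M := B) (f := Complex.ofRealHom)
  have h2 := Matrix.map_pow A k (f := Complex.ofRealHom)
  rw [h2] at h
  exact h

/-- The number of real inputs of a controllable pair bounds every complex geometric
multiplicity. -/
theorem KalmanControllable.sub_rank_le {N M : ℕ} {A : Matrix (Fin N) (Fin N) ℝ}
    {B : Matrix (Fin N) (Fin M) ℝ} (h : KalmanControllable A B) (c : ℂ) :
    N - (c • (1 : Matrix (Fin N) (Fin N) ℂ) - A.map Complex.ofReal).rank ≤ M := by
  rw [← Matrix.finrank_ker_mulVecLin_transpose]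
  set W := LinearMap.ker (c • (1 : Matrix (Fin N) (Fin N) ℂ) - A.map Complex.ofReal)ᵀ.mulVecLin
  have hinj : Function.Injective ((B.map Complex.ofReal).vecMulLinear.domRestrict W) := by
    rw [injective_iff_map_eq_zero]
    rintro ⟨w, hw⟩ hwB
    have hwB : w ᵥ* B.map Complex.ofReal = 0 := hwB
    have hw := mem_ker_transpose_smul_one_sub.mp hw
    refine Subtype.ext (Matrix.eq_zero_of_vecMul_map_ofReal
      ((Matrix.rank_eq_iff_vecMul_eq_zero _).mp h) ?_)
    ext ⟨k, j⟩
    have hk : w ᵥ* (A ^ (k : ℕ) * B).map Complex.ofReal = 0 := by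
      rw [Matrix.map_ofReal_pow_mul, ← Matrix.vecMul_vecMul, Matrix.vecMul_pow_of_eigen hw,
        Matrix.smul_vecMul, hwB, smul_zero]
    exact congrFun hk j
  simpa using LinearMap.finrank_le_finrank_of_injective hinj

/-- The Popov–Belevitch–Hautus test: if no complex left eigenvector of `A` is annihilated by `B`,
then the real pair `(A, B)` is controllable. -/
theorem kalmanControllable_of_left_eigenvectors {N M : ℕ} {A : Matrix (Fin N) (Fin N) ℝ}
    {B : Matrix (Fin N) (Fin M) ℝ}
    (h : ∀ (c : ℂ) (w : Fin N → ℂ), w ᵥ* A.map Complex.ofReal = c • w →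
      w ᵥ* B.map Complex.ofReal = 0 → w = 0) : KalmanControllable A B := by
  refine (Matrix.rank_eq_iff_vecMul_eq_zero _).mpr fun v hv => ?_
  by_contra hne
  let U : Submodule ℂ (Fin N → ℂ) :=
    ⨅ k : ℕ, LinearMap.ker (A.map Complex.ofReal ^ k * B.map Complex.ofReal).vecMulLinear
  have hU : ∀ w, w ∈ U ↔
      ∀ k : ℕ, w ᵥ* (A.map Complex.ofReal ^ k * B.map Complex.ofReal) = 0 := fun w => by
    simp [U, Submodule.mem_iInf]
  have hvU : (fun i => (v i : ℂ)) ∈ U := (hU _).mpr fun k => by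
    rw [← Matrix.map_ofReal_pow_mul]
    ext j
    have := congrArg Complex.ofReal
      (congrFun (vecMul_pow_mul_eq_zero_of_vecMul_ctrbMatrix hv k) j)
    simpa [Matrix.vecMul, dotProduct] using this
  have hinv : ∀ w ∈ U, (A.map Complex.ofReal).vecMulLinear w ∈ U := fun w hw =>
    (hU _).mpr fun k => by
      have := (hU w).mp hw (k + 1)
      rwa [pow_succ', Matrix.mul_assoc, ← Matrix.vecMul_vecMul] at this
  have : Nontrivial U := ⟨⟨_, hvU⟩, 0, fun h0 => hne (by
    ext i
    exact Complex.ofReal_eq_zero.mp (congrFun (congrArg Subtype.val h0) i))⟩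
  obtain ⟨c, hc⟩ := Module.End.exists_eigenvalue
    ((A.map Complex.ofReal).vecMulLinear.restrict hinv)
  obtain ⟨w, hw⟩ := hc.exists_hasEigenvector
  refine hw.2 (Subtype.ext (h c w ?_ ?_))
  · exact congrArg Subtype.val hw.apply_eq_smul
  · simpa using (hU w).mp w.2 0

theorem det_smul_one_sub_eq_zero_iff {F : Type*} [Field F] {N : ℕ}
    (P : Matrix (Fin N) (Fin N) F) (c : F) :
    (c • (1 : Matrix (Fin N) (Fin N) F) - P).det = 0 ↔ P.charpoly.IsRoot c := by
  rw [Polynomial.IsRoot, Matrix.eval_charpoly, Matrix.smul_one_eq_diagonal]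
  rfl

/-- Exact controllability theory for real state matrices: the least `M ≥ 1` admitting a real
`N × M` control matrix `B` with `(A, B)` Kalman controllable equals the maximum geometric
multiplicity `N − rank_ℂ(λI − A)` over the complex eigenvalues `λ` of `A`. -/
theorem exact_controllability_real {N : ℕ} (hN : 1 ≤ N) (A : Matrix (Fin N) (Fin N) ℝ) :
    sInf {M : ℕ | 1 ≤ M ∧ ∃ B : Matrix (Fin N) (Fin M) ℝ, KalmanControllable A B} =
      sSup {m : ℕ | ∃ lam : ℂ,
        (lam • (1 : Matrix (Fin N) (Fin N) ℂ) - A.map Complex.ofReal).det = 0 ∧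
        m = N - (lam • (1 : Matrix (Fin N) (Fin N) ℂ) - A.map Complex.ofReal).rank} := by
  set P := A.map Complex.ofReal
  set S := {m : ℕ | ∃ lam : ℂ, (lam • (1 : Matrix (Fin N) (Fin N) ℂ) - P).det = 0 ∧
    m = N - (lam • (1 : Matrix (Fin N) (Fin N) ℂ) - P).rank}
  have hbdd : BddAbove S := ⟨N, by
    rintro _ ⟨c, _, rfl⟩
    exact Nat.sub_le _ _⟩
  obtain ⟨c₀, hc₀⟩ : ∃ c, P.charpoly.IsRoot c := IsAlgClosed.exists_root _ (by
    rw [Matrix.charpoly_degree_eq_dim, Fintype.card_fin]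
    exact_mod_cast Nat.one_le_iff_ne_zero.mp hN)
  rw [← det_smul_one_sub_eq_zero_iff] at hc₀
  have hne : S.Nonempty := ⟨_, c₀, hc₀, rfl⟩
  have hpos : 1 ≤ sSup S := by
    refine le_trans ?_ (le_csSup hbdd ⟨c₀, hc₀, rfl⟩)
    rw [← Matrix.finrank_ker_mulVecLin_transpose, Submodule.one_le_finrank_iff]
    obtain ⟨w, hw0, hw⟩ := Matrix.exists_vecMul_eq_zero_iff.mpr hc₀
    refine (Submodule.ne_bot_iff _).mpr ⟨w, ?_, hw0⟩
    rwa [LinearMap.mem_ker, Matrix.mulVecLin_apply, Matrix.mulVec_transpose]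
  have hmem : sSup S ∈
      {M : ℕ | 1 ≤ M ∧ ∃ B : Matrix (Fin N) (Fin M) ℝ, KalmanControllable A B} := by
    obtain ⟨b, hb⟩ := exists_real_forms_separating (sSup S) P.charpoly.roots.toFinset
      (fun c => LinearMap.ker (c • (1 : Matrix (Fin N) (Fin N) ℂ) - P)ᵀ.mulVecLin)
      (fun c hc => by
        rw [Matrix.finrank_ker_mulVecLin_transpose]
        rw [Multiset.mem_toFinset, Polynomial.mem_roots P.charpoly_monic.ne_zero,
          ← det_smul_one_sub_eq_zero_iff] at hc
        exact le_csSup hbdd ⟨c, hc, rfl⟩)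
    refine ⟨hpos, Matrix.of fun l j => b j l, kalmanControllable_of_left_eigenvectors
      fun c w hw hwB => ?_⟩
    by_contra hw0
    have hker := mem_ker_transpose_smul_one_sub.mpr hw
    refine hw0 (hb c ?_ w hker fun j => congrFun hwB j)
    rw [Multiset.mem_toFinset, Polynomial.mem_roots P.charpoly_monic.ne_zero,
      ← det_smul_one_sub_eq_zero_iff]
    refine Matrix.exists_vecMul_eq_zero_iff.mp ⟨w, hw0, ?_⟩
    rwa [LinearMap.mem_ker, Matrix.mulVecLin_apply, Matrix.mulVec_transpose] at hker
  refine le_antisymm (Nat.sInf_le hmem) (le_csInf ⟨_, hmem⟩ ?_)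
  rintro M ⟨_, B, hB⟩
  refine csSup_le hne ?_
  rintro _ ⟨c, _, rfl⟩
  exact hB.sub_rank_le c
end

section
/- (Exact controllability for symmetric matrices) Let A be a real symmetric N×N matrix with N ≥ 1. Then the least M ≥ 1 for which there exists a real N×M matrix B with (A,B) Kalman controllable equals the maximum algebraic multiplicity of the eigenvalues of A, i.e., the maximum over real eigenvalues λ of A of the multiplicity of λ as a root of the characteristic polynomial of A. -/
open Matrix Polynomial

theorem kalmanControllable_iff_vecMul {F : Type*} [Field F] {N M : ℕ}
    (A : Matrix (Fin N) (Fin N) F) (B : Matrix (Fin N) (Fin M) F) :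
    KalmanControllable A B ↔
      ∀ v : Fin N → F, (∀ k < N, v ᵥ* (A ^ k * B) = 0) → v = 0 := by
  have h : KalmanControllable A B ↔ Function.Injective (ctrbMatrix A B).vecMul := by
    rw [vecMul_injective_iff, linearIndependent_iff_card_eq_finrank_span, KalmanControllable,
      rank_eq_finrank_span_row, Fintype.card_fin, eq_comm, Set.finrank]
  have key (v : Fin N → F) :
      v ᵥ* ctrbMatrix A B = 0 ↔ ∀ k < N, v ᵥ* (A ^ k * B) = 0 := by
    constructor
    · intro hv k hk
      ext j
      exact congrFun hv (⟨k, hk⟩, j)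
    · intro hv
      ext ⟨k, j⟩
      exact congrFun (hv k k.2) j
  rw [h]
  constructor
  · intro hinj v hv
    exact hinj (((key v).2 hv).trans (zero_vecMul _).symm)
  · intro hv v w hvw
    refine sub_eq_zero.1 (hv _ ((key _).1 ?_))
    rw [sub_vecMul, sub_eq_zero]
    exact hvw

theorem kalmanControllable_conj {F : Type*} [Field F] {N M : ℕ}
    {P Q : Matrix (Fin N) (Fin N) F} (hQP : Q * P = 1)
    (A : Matrix (Fin N) (Fin N) F) (B : Matrix (Fin N) (Fin M) F) :
    KalmanControllable (P * A * Q) (P * B) ↔ KalmanControllable A B := by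
  have hpow (k : ℕ) : (P * A * Q) ^ k * P = P * A ^ k := by
    induction k with
    | zero => simp
    | succ k ih =>
      calc (P * A * Q) ^ (k + 1) * P = (P * A * Q) ^ k * P * A * (Q * P) := by
            simp only [pow_succ, Matrix.mul_assoc]
        _ = P * A ^ (k + 1) := by rw [ih, hQP, Matrix.mul_one, pow_succ, Matrix.mul_assoc]
  have hP : ctrbMatrix (P * A * Q) (P * B) = P * ctrbMatrix A B := by
    ext i ⟨k, j⟩
    change ((P * A * Q) ^ (k : ℕ) * (P * B)) i j = _
    rw [← Matrix.mul_assoc, hpow, Matrix.mul_assoc]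
    rfl
  rw [KalmanControllable, KalmanControllable, hP,
    rank_mul_eq_right_of_isUnit_det _ _ (isUnit_det_of_left_inverse hQP)]

theorem card_fiber_le_of_kalmanControllable_diagonal {F : Type*} [Field F] [DecidableEq F]
    {N M : ℕ} (d : Fin N → F) (B : Matrix (Fin N) (Fin M) F)
    (h : KalmanControllable (diagonal d) B) (a : F) :
    (Finset.univ.filter fun i => d i = a).card ≤ M := by
  rw [kalmanControllable_iff_vecMul] at h
  have hinj : Function.Injective
      (B.submatrix (Subtype.val : {i // d i = a} → Fin N) id).vecMulLinear := by
    rw [injective_iff_map_eq_zero]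
    intro w hw
    let v : Fin N → F := fun i => if hi : d i = a then w ⟨i, hi⟩ else 0
    have hvB : v ᵥ* B = 0 := by
      rw [← hw]
      ext j
      simp only [vecMulLinear_apply, vecMul, dotProduct, submatrix_apply, id]
      rw [← Finset.sum_filter_of_ne (p := fun i => d i = a) fun i _ hi => ?_,
        Finset.sum_subtype (p := fun i => d i = a) _ (by simp)]
      · exact Finset.sum_congr rfl fun i _ => by simp [v, i.2]
      · by_contra hia
        simp [v, hia] at hi
    have hv : v = 0 := by
      refine h v fun k _ => ?_
      have hk : v ᵥ* diagonal d ^ k = a ^ k • v := by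
        ext i
        rw [diagonal_pow, vecMul_diagonal]
        by_cases hi : d i = a <;> simp [v, hi, mul_comm]
      rw [← vecMul_vecMul, hk, smul_vecMul, hvB, smul_zero]
    ext ⟨i, hi⟩
    simpa [v, hi] using congrFun hv i
  simpa [Fintype.card_subtype] using LinearMap.finrank_le_finrank_of_injective hinj

theorem exists_kalmanControllable_diagonal {F : Type*} [Field F] [DecidableEq F]
    {N M : ℕ} (d : Fin N → F)
    (hM : ∀ i, (Finset.univ.filter fun j => d j = d i).card ≤ M) :
    ∃ B : Matrix (Fin N) (Fin M) F, KalmanControllable (diagonal d) B := by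
  let r : Fin N → ℕ := fun i => (Finset.univ.filter fun j => j < i ∧ d j = d i).card
  have hr (i : Fin N) : r i < M := by
    refine (Finset.card_lt_card ?_).trans_le (hM i)
    refine Finset.ssubset_iff_of_subset (fun j => by simp) |>.2 ⟨i, by simp, by simp⟩
  have hlt {i j : Fin N} (hij : i < j) (hd : d i = d j) : r i < r j := by
    refine Finset.card_lt_card (Finset.ssubset_iff_of_subset ?_ |>.2 ⟨i, ?_, ?_⟩)
    · intro l
      simp only [Finset.mem_filter, Finset.mem_univ, true_and]
      exact fun hl => ⟨hl.1.trans hij, hl.2.trans hd⟩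
    · simp [hij, hd]
    · simp
  have hinj {i j : Fin N} (hrij : r i = r j) (hd : d i = d j) : i = j := by
    rcases lt_trichotomy i j with h | h | h
    · exact absurd hrij (hlt h hd).ne
    · exact h
    · exact absurd hrij (hlt h hd.symm).ne'
  refine ⟨Matrix.of fun i j => if r i = j then 1 else 0,
    (kalmanControllable_iff_vecMul _ _).2 fun w hw => ?_⟩
  have hpow (j : Fin M) (k : ℕ) (hk : k < N) :
      ∑ i with r i = j, w i * d i ^ k = 0 := by
    have := congrFun (hw k hk) j
    rw [← vecMul_vecMul, diagonal_pow] at this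
    simpa [vecMul, dotProduct, vecMul_diagonal, diagonal_apply, Finset.sum_filter] using this
  have hpoly (j : Fin M) (p : F[X]) (hp : p.natDegree < N) :
      ∑ i with r i = j, w i * p.eval (d i) = 0 := by
    simp only [eval_eq_sum_range, Finset.mul_sum]
    rw [Finset.sum_comm]
    refine Finset.sum_eq_zero fun k hk => ?_
    have := hpow j k (by have := Finset.mem_range.1 hk; omega)
    calc _ = p.coeff k * ∑ i with r i = j, w i * d i ^ k := by
          rw [Finset.mul_sum]; exact Finset.sum_congr rfl fun i _ => by ring
      _ = 0 := by rw [this, mul_zero]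
  ext i
  let s := (Finset.univ.filter fun l => r l = r i).erase i
  have hs : s.card < N := by
    have h : s ⊂ Finset.univ := Finset.ssubset_univ_iff.2 fun h =>
      Finset.notMem_erase i _ (h.symm.subset (Finset.mem_univ i))
    simpa using Finset.card_lt_card h
  have h := hpoly ⟨r i, hr i⟩ (∏ l ∈ s, (X - C (d l))) (by
    rwa [natDegree_prod_of_monic _ _ fun l _ => monic_X_sub_C _, Finset.sum_congr rfl
      fun l _ => natDegree_X_sub_C _, Finset.sum_const, smul_eq_mul, mul_one])
  rw [Finset.sum_eq_single i] at h
  · rw [eval_prod] at h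
    refine (mul_eq_zero.1 h).resolve_right (Finset.prod_ne_zero_iff.2 fun l hl => ?_)
    simp only [s, Finset.mem_erase, Finset.mem_filter, Finset.mem_univ, true_and] at hl
    rw [eval_sub, eval_X, eval_C, sub_ne_zero]
    exact fun hd => hl.1 (hinj hl.2 hd.symm)
  · intro l hl hli
    have hls : l ∈ s := by
      simpa [s, hli] using hl
    rw [eval_prod, Finset.prod_eq_zero hls (by simp), mul_zero]
  · simp

theorem Matrix.IsHermitian.rootMultiplicity_charpoly_eq_card {N : ℕ}
    {A : Matrix (Fin N) (Fin N) ℝ} (hA : A.IsHermitian) (a : ℝ) :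
    A.charpoly.rootMultiplicity a = (Finset.univ.filter fun i => hA.eigenvalues i = a).card := by
  rw [← count_roots, hA.roots_charpoly_eq_eigenvalues, Multiset.count_map]
  simp [Finset.card_def, eq_comm]

/-- Exact controllability for real symmetric matrices: the least `M ≥ 1` admitting a real
`N × M` control matrix `B` with `(A, B)` Kalman controllable equals the maximum algebraic
multiplicity of the (real) eigenvalues of `A`, i.e. the maximum multiplicity of a root of
the characteristic polynomial of `A`. -/
theorem exact_controllability_symmetric {N : ℕ} (hN : 1 ≤ N)
    (A : Matrix (Fin N) (Fin N) ℝ) (hA : A.IsSymm) :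
    sInf {M : ℕ | 1 ≤ M ∧ ∃ B : Matrix (Fin N) (Fin M) ℝ, KalmanControllable A B} =
      sSup {m : ℕ | ∃ lam : ℝ, A.charpoly.IsRoot lam ∧
        m = A.charpoly.rootMultiplicity lam} := by
  have hH : A.IsHermitian := by
    rwa [IsHermitian, conjTranspose_eq_transpose_of_trivial]
  let d := hH.eigenvalues
  let U : Matrix (Fin N) (Fin N) ℝ := hH.eigenvectorUnitary
  have hU : star U * U = 1 := Unitary.coe_star_mul_self _
  have hU' : U * star U = 1 := Unitary.coe_mul_star_self _
  have hAU : A = U * diagonal d * star U := by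
    simpa [Unitary.conjStarAlgAut_apply] using hH.spectral_theorem
  have hdiag {M : ℕ} (B : Matrix (Fin N) (Fin M) ℝ) :
      KalmanControllable A (U * B) ↔ KalmanControllable (diagonal d) B := by
    rw [hAU]
    exact kalmanControllable_conj hU _ _
  have hmem (i : Fin N) : (Finset.univ.filter fun j => d j = d i).card ∈
      {m : ℕ | ∃ lam : ℝ, A.charpoly.IsRoot lam ∧ m = A.charpoly.rootMultiplicity lam} := by
    refine ⟨d i, ?_, (hH.rootMultiplicity_charpoly_eq_card _).symm⟩
    rw [← rootMultiplicity_pos A.charpoly_monic.ne_zero, hH.rootMultiplicity_charpoly_eq_card]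
    exact Finset.card_pos.2 ⟨i, by simp [d]⟩
  have hbdd : BddAbove
      {m : ℕ | ∃ lam : ℝ, A.charpoly.IsRoot lam ∧ m = A.charpoly.rootMultiplicity lam} := by
    refine ⟨N, ?_⟩
    rintro _ ⟨a, -, rfl⟩
    rw [hH.rootMultiplicity_charpoly_eq_card]
    simpa using Finset.card_le_univ (Finset.univ.filter fun i => hH.eigenvalues i = a)
  have hsup : sSup {m : ℕ | ∃ lam : ℝ, A.charpoly.IsRoot lam ∧
      m = A.charpoly.rootMultiplicity lam} ∈
      {M : ℕ | 1 ≤ M ∧ ∃ B : Matrix (Fin N) (Fin M) ℝ, KalmanControllable A B} := by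
    refine ⟨?_, ?_⟩
    · refine le_trans ?_ (le_csSup hbdd (hmem ⟨0, hN⟩))
      exact Finset.card_pos.2 ⟨⟨0, hN⟩, by simp⟩
    · obtain ⟨B, hB⟩ := exists_kalmanControllable_diagonal d fun i => le_csSup hbdd (hmem i)
      exact ⟨U * B, (hdiag B).2 hB⟩
  refine le_antisymm (Nat.sInf_le hsup) (csSup_le ⟨_, hmem ⟨0, hN⟩⟩ ?_)
  rintro _ ⟨a, -, rfl⟩
  obtain ⟨-, B, hB⟩ := Nat.sInf_mem ⟨_, hsup⟩
  rw [hH.rootMultiplicity_charpoly_eq_card]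
  refine card_fiber_le_of_kalmanControllable_diagonal d (star U * B) ((hdiag _).1 ?_) a
  rwa [← Matrix.mul_assoc, hU', Matrix.one_mul]
end

section
/- If a complex N×N matrix A has N distinct eigenvalues, then a single control input suffices: there exists a vector b ∈ ℂ^N such that the N×N matrix [b, Ab, A²b, …, A^{N−1}b] has rank N. -/
/-- The single-input controllability matrix of `(A, b)`: the `N × N` matrix whose `k`-th
column is `A^k b`. -/
def singleInputCtrbMatrix {F : Type*} [Field F] {N : ℕ}
    (A : Matrix (Fin N) (Fin N) F) (b : Fin N → F) :
    Matrix (Fin N) (Fin N) F :=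
  Matrix.of fun i k => (A ^ (k : ℕ)).mulVec b i

/-- Over a sum of eigenvectors, the controllability matrix factors as the matrix of eigenvectors
times the Vandermonde matrix of the eigenvalues. -/
theorem singleInputCtrbMatrix_sum_eigenvectors {F : Type*} [Field F] {N : ℕ}
    (A : Matrix (Fin N) (Fin N) F) (μ : Fin N → F) (v : Fin N → Fin N → F)
    (hv : ∀ j, A.mulVec (v j) = μ j • v j) :
    singleInputCtrbMatrix A (∑ j, v j) =
      (Matrix.of v).transpose * Matrix.vandermonde μ := by
  have hpow (k : ℕ) (j : Fin N) : (A ^ k).mulVec (v j) = μ j ^ k • v j := by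
    induction k with
    | zero => simp
    | succ k ih =>
      rw [pow_succ, ← Matrix.mulVec_mulVec, hv, Matrix.mulVec_smul, ih, smul_smul, pow_succ']
  ext i k
  simp [singleInputCtrbMatrix, Matrix.mulVec_sum, hpow, Matrix.mul_apply, mul_comm]

/-- A matrix with pairwise distinct eigenvalues, one for each index, is controllable with a single
input. -/
theorem exists_rank_singleInputCtrbMatrix_eq {F : Type*} [Field F] {N : ℕ}
    (A : Matrix (Fin N) (Fin N) F) (μ : Fin N → F) (hμ : Function.Injective μ)
    (hroot : ∀ j, A.charpoly.IsRoot (μ j)) :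
    ∃ b : Fin N → F, (singleInputCtrbMatrix A b).rank = N := by
  have heig (j : Fin N) : Module.End.HasEigenvalue (Matrix.toLin' A) (μ j) := by
    rw [Module.End.hasEigenvalue_iff_isRoot_charpoly, Matrix.charpoly_toLin']
    exact hroot j
  choose v hv using fun j => (heig j).exists_hasEigenvector
  have hli : LinearIndependent F v :=
    Module.End.eigenvectors_linearIndependent' (Matrix.toLin' A) μ hμ v hv
  have hP : IsUnit (Matrix.of v).transpose :=
    (Matrix.isUnit_transpose _).2 (Matrix.linearIndependent_rows_iff_isUnit.1 hli)
  have hV : IsUnit (Matrix.vandermonde μ) :=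
    (Matrix.isUnit_iff_isUnit_det _).2 (Matrix.det_vandermonde_ne_zero_iff.2 hμ).isUnit
  refine ⟨∑ j, v j, ?_⟩
  rw [singleInputCtrbMatrix_sum_eigenvectors A μ v fun j => by simpa using (hv j).apply_eq_smul,
    Matrix.rank_of_isUnit _ (hP.mul hV), Fintype.card_fin]

/-- If a complex `N × N` matrix has `N` distinct eigenvalues (its characteristic polynomial
has `N` distinct complex roots), then a single control input suffices: some `b ∈ ℂ^N` makes
`[b, Ab, …, A^{N−1}b]` have full rank `N`. -/
theorem single_input_of_distinct_eigenvalues {N : ℕ}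
    (A : Matrix (Fin N) (Fin N) ℂ) (h : A.charpoly.roots.toFinset.card = N) :
    ∃ b : Fin N → ℂ, (singleInputCtrbMatrix A b).rank = N := by
  let e := A.charpoly.roots.toFinset.equivFinOfCardEq h
  exact exists_rank_singleInputCtrbMatrix_eq A (fun j => (e.symm j : ℂ))
    (Subtype.val_injective.comp e.symm.injective) fun j =>
      Polynomial.isRoot_of_mem_roots (Multiset.mem_toFinset.1 (e.symm j).2)
end

section
/- (Dominance of the prevailing self-loop) Let A be a real N×N matrix, D a real diagonal N×N matrix, w a real number, and let S = {i : D_ii = w} be the set of nodes carrying a self-loop of weight w. If B is a real N×M matrix such that (A + D, B) is Kalman controllable, then M ≥ |S| − rank(A). -/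
/-- The rank of matrices over a field is subadditive. -/
theorem rank_matrix_add_le {F m n : Type*} [Field F] [Fintype m] [Fintype n]
    (A B : Matrix m n F) : (A + B).rank ≤ A.rank + B.rank := by
  have hle : LinearMap.range (A + B).mulVecLin ≤
      LinearMap.range A.mulVecLin ⊔ LinearMap.range B.mulVecLin := by
    rw [Matrix.mulVecLin_add]
    exact LinearMap.range_add_le _ _
  exact (Submodule.finrank_mono hle).trans (Submodule.finrank_add_le_finrank_add_finrank _ _)

/-- The range of the controllability matrix lies in the range of `Φ - w` plus that of `B`. -/
theorem rank_ctrbMatrix_le {F : Type*} [Field F] {N M : ℕ}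
    (A : Matrix (Fin N) (Fin N) F) (B : Matrix (Fin N) (Fin M) F) (w : F) :
    (ctrbMatrix A B).rank ≤ (A - Matrix.scalar (Fin N) w).rank + M := by
  have hpow (k : ℕ) : ∃ X : Matrix (Fin N) (Fin N) F,
      A ^ k - Matrix.scalar (Fin N) w ^ k = (A - Matrix.scalar (Fin N) w) * X :=
    (Matrix.scalar_commute w (Commute.all w) A).symm.sub_dvd_pow_sub_pow k
  choose X hX using hpow
  have hK : ctrbMatrix A B =
      (A - Matrix.scalar (Fin N) w) *
          (Matrix.of fun i (p : Fin N × Fin M) => (X p.1 * B) i p.2) +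
        B * (Matrix.of fun j (p : Fin N × Fin M) => if j = p.2 then w ^ (p.1 : ℕ) else 0) := by
    ext i ⟨k, j⟩
    have h1 : A ^ (k : ℕ) * B =
        (A - Matrix.scalar (Fin N) w) * (X k * B) + Matrix.scalar (Fin N) (w ^ (k : ℕ)) * B := by
      rw [← Matrix.mul_assoc, ← hX, ← Matrix.add_mul, map_pow, sub_add_cancel]
    have h2 := congrFun (congrFun h1 i) j
    simp only [ctrbMatrix, Matrix.of_apply, h2, Matrix.add_apply]
    congr 1
    simp [Matrix.mul_apply, Matrix.diagonal_apply, mul_comm]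
  rw [hK]
  refine (rank_matrix_add_le _ _).trans (add_le_add (Matrix.rank_mul_le_left _ _) ?_)
  exact (Matrix.rank_mul_le_left _ _).trans (Matrix.rank_le_width B)

/-- Dominance of the prevailing self-loop: if `D` is diagonal, `S = {i : D i i = w}` is the
set of nodes with a self-loop of weight `w`, and `(A + D, B)` is Kalman controllable, then
the number of control inputs satisfies `M ≥ |S| − rank A`. -/
theorem prevailing_selfloop_bound {N M : ℕ}
    (A D : Matrix (Fin N) (Fin N) ℝ) (hD : D.IsDiag) (w : ℝ)
    (B : Matrix (Fin N) (Fin M) ℝ) (h : KalmanControllable (A + D) B) :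
    (Finset.univ.filter fun i : Fin N => D i i = w).card - A.rank ≤ M := by
  have hDw : D - Matrix.scalar (Fin N) w = Matrix.diagonal fun i => D i i - w := by
    conv_lhs => rw [← hD.diagonal_diag]
    ext i j
    by_cases hij : i = j <;> simp [hij]
  have hrank : (D - Matrix.scalar (Fin N) w).rank +
      (Finset.univ.filter fun i : Fin N => D i i = w).card = N := by
    rw [hDw, Matrix.rank_diagonal, Fintype.card_subtype, add_comm]
    simpa [sub_eq_zero] using
      Finset.card_filter_add_card_filter_not (s := Finset.univ) fun i : Fin N => D i i = w
  have hK := rank_ctrbMatrix_le (A + D) B w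
  have hadd := rank_matrix_add_le A (D - Matrix.scalar (Fin N) w)
  rw [← add_sub_assoc] at hadd
  rw [KalmanControllable] at h
  omega
end

section
/- (Fully independent self-loops produce simple spectrum) Let A be an N×N matrix with rational entries, and let Λ be a real diagonal N×N matrix whose N diagonal entries are algebraically independent over ℚ. Then the characteristic polynomial of A + Λ is separable, i.e., A + Λ has N distinct complex eigenvalues. -/
open Polynomial in
/-- The resultant is taken in fixed formal degrees, so that it commutes with ring homomorphisms. -/
lemma Polynomial.Monic.separable_iff_resultant_ne_zero {K : Type*} [Field K] {f : K[X]}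
    (hf : f.Monic) {n : ℕ} (hn : f.natDegree = n) :
    f.Separable ↔ f.resultant f.derivative n (n - 1) ≠ 0 := by
  have hle : f.derivative.natDegree ≤ n - 1 := hn ▸ natDegree_derivative_le f
  obtain ⟨k, hk⟩ := Nat.exists_eq_add_of_le hle
  subst hn
  rw [hk, resultant_add_right_deg _ _ _ _ _ le_rfl, hf.coeff_natDegree, one_pow,
    one_mul, Polynomial.Separable, ← isUnit_resultant_iff_isCoprime hf, isUnit_iff_ne_zero]

open Polynomial in
/-- Precomposition with `c * X` preserves separability when `c` is nonzero. -/
lemma Polynomial.Separable.comp_C_mul_X {K : Type*} [Field K] {f : K[X]} (hf : f.Separable)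
    {c : K} (hc : c ≠ 0) : (f.comp (C c * X)).Separable := by
  have hu : IsUnit (C c) := isUnit_C.mpr hc.isUnit
  have h := IsCoprime.map hf (compRingHom (C c * X))
  rw [Polynomial.Separable, derivative_comp, derivative_C_mul_X]
  exact (isCoprime_mul_unit_left_right hu _ _).mpr h

namespace Matrix

open Polynomial

variable {n : Type*} [Fintype n] [DecidableEq n]

lemma charpoly_smul_comp {R : Type*} [CommRing R] (M : Matrix n n R) (c : R) :
    (c • M).charpoly.comp (C c * X) = C (c ^ Fintype.card n) * M.charpoly := by
  rw [charpoly, charpoly, ← coe_compRingHom_apply, RingHom.map_det, C_pow, ← det_smul]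
  congr 1
  ext1 i j
  by_cases h : i = j
  · subst h; simp [mul_sub]
  · simp [h]

lemma separable_charpoly_of_smul {K : Type*} [Field K] {M : Matrix n n K} {c : K} (hc : c ≠ 0)
    (h : (c • M).charpoly.Separable) : M.charpoly.Separable := by
  have h' := h.comp_C_mul_X hc
  rw [charpoly_smul_comp] at h'
  exact h'.of_mul_right

lemma separable_charpoly_diagonal {K : Type*} [Field K] {d : n → K}
    (hd : Function.Injective d) : (diagonal d).charpoly.Separable := by
  rw [charpoly_diagonal]
  exact separable_prod_X_sub_C_iff.mpr hd

/-- The discriminant of the characteristic polynomial, up to sign. -/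
noncomputable def charpolyResultant {R : Type*} [CommRing R] (M : Matrix n n R) : R :=
  M.charpoly.resultant M.charpoly.derivative (Fintype.card n) (Fintype.card n - 1)

lemma charpolyResultant_map {R S : Type*} [CommRing R] [CommRing S] (f : R →+* S)
    (M : Matrix n n R) : (M.map f).charpolyResultant = f M.charpolyResultant := by
  rw [charpolyResultant, charpoly_map, derivative_map, resultant_map_map, charpolyResultant]

lemma separable_charpoly_iff {K : Type*} [Field K] (M : Matrix n n K) :
    M.charpoly.Separable ↔ M.charpolyResultant ≠ 0 :=
  M.charpoly_monic.separable_iff_resultant_ne_zero M.charpoly_natDegree_eq_dim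

lemma exists_separable_charpoly_add_diagonal {K : Type*} [Field K] [Infinite K]
    (A : Matrix n n K) : ∃ d : n → K, (A + diagonal d).charpoly.Separable := by
  let e : n ↪ K :=
    ((Fintype.equivFin n).toEmbedding.trans Fin.valEmbedding).trans (Infinite.natEmbedding K)
  let P : Matrix n n K[X] := (X : K[X]) • A.map C + diagonal fun i ↦ C (e i)
  have hP (t : K) : P.map (evalRingHom t) = t • A + diagonal e := by
    ext i j
    by_cases h : i = j
    · subst h; simp [P, mul_comm t]
    · simp [P, h, mul_comm t]
  have h0 : P.charpolyResultant ≠ 0 := by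
    intro h
    refine (separable_charpoly_iff _).mp (separable_charpoly_diagonal e.injective) ?_
    have := charpolyResultant_map (evalRingHom 0) P
    rwa [hP, zero_smul, zero_add, h, map_zero] at this
  obtain ⟨t, ht⟩ : ∃ t, (P.charpolyResultant * X).eval t ≠ 0 := by
    by_contra! h
    exact mul_ne_zero h0 X_ne_zero (Polynomial.funext (by simpa using h))
  rw [eval_mul, eval_X] at ht
  have ht0 := right_ne_zero_of_mul ht
  refine ⟨t⁻¹ • ⇑e, separable_charpoly_of_smul ht0 ?_⟩
  rw [smul_add, diagonal_smul, smul_smul, mul_inv_cancel₀ ht0, one_smul, separable_charpoly_iff,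
    ← hP, charpolyResultant_map]
  exact left_ne_zero_of_mul ht

lemma aeval_charpolyResultant_add_diagonal_X {K S : Type*} [CommRing K] [CommRing S] [Algebra K S]
    (A : Matrix n n K) (x : n → S) :
    MvPolynomial.aeval x
        (A.map MvPolynomial.C + diagonal MvPolynomial.X : Matrix n n _).charpolyResultant =
      (A.map (algebraMap K S) + diagonal x).charpolyResultant := by
  rw [← AlgHom.coe_toRingHom, ← charpolyResultant_map]
  congr 1
  ext i j
  by_cases h : i = j
  · subst h; simp
  · simp [h]

lemma separable_charpoly_add_diagonal {K L : Type*} [Field K] [Infinite K] [Field L] [Algebra K L]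
    (A : Matrix n n K) {d : n → L} (hd : AlgebraicIndependent K d) :
    (A.map (algebraMap K L) + diagonal d).charpoly.Separable := by
  obtain ⟨c, hc⟩ := exists_separable_charpoly_add_diagonal A
  rw [separable_charpoly_iff] at hc ⊢
  rw [← aeval_charpolyResultant_add_diagonal_X]
  intro h
  apply hc
  rw [← A.map_id, ← RingHom.coe_id, ← Algebra.algebraMap_self,
    ← aeval_charpolyResultant_add_diagonal_X, hd (h.trans (map_zero _).symm), map_zero]

end Matrix

/-- Fully independent self-loops produce a simple spectrum: if `A` has rational entries and
the diagonal self-loop weights `d 0, …, d (N−1)` are algebraically independent over `ℚ`,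
then the characteristic polynomial of `A + diagonal d` is separable, i.e. `A + diagonal d`
has `N` distinct complex eigenvalues. -/
theorem independent_selfloops_simple_spectrum {N : ℕ}
    (A : Matrix (Fin N) (Fin N) ℚ) (d : Fin N → ℝ)
    (hd : AlgebraicIndependent ℚ d) :
    ((A.map (Rat.cast : ℚ → ℝ) + Matrix.diagonal d).charpoly).Separable ∧
      (((A.map (Rat.cast : ℚ → ℝ) + Matrix.diagonal d).charpoly.map
          Complex.ofRealHom).roots.toFinset.card = N) := by
  have h : ((A.map (Rat.cast : ℚ → ℝ) + Matrix.diagonal d).charpoly).Separable :=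
    Matrix.separable_charpoly_add_diagonal A hd
  refine ⟨h, ?_⟩
  rw [Multiset.toFinset_card_of_nodup (Polynomial.nodup_roots h.map),
    ← (IsAlgClosed.splits _).natDegree_eq_card_roots, Polynomial.natDegree_map,
    Matrix.charpoly_natDegree_eq_dim, Fintype.card_fin]
end
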